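/- (Pathwise running supremum of the taxed process, observation (ii) of Section 4.1) Let x ∈ ℝ, let X : [0,∞) → ℝ be any function with X(0) = x whose running supremum X̄(t) := sup_{0≤s≤t} X(s) is finite for each t, and let γ : [0,∞) → [0,1) be measurable. Define ξ_γ(z) = ∫_x^z γ(w) dw for z ≥ x and the taxed path U_γ(s) = X(s) − ξ_γ(X̄(s)). Then for every t ≥ 0: sup_{0≤s≤t} U_γ(s) = X̄(t) − ξ_γ(X̄(t)). -/

import Mathlib

open MeasureTheory Set

/-- The primitive of a function with values in `[0, 1)` is monotone. -/
theorem monotone_primitive_of_mem_Ico {γ : ℝ → ℝ} (hγ : ∀ w, γ w ∈ Ico (0 : ℝ) 1)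
    (hint : ∀ a b, IntervalIntegrable γ volume a b) (x : ℝ) :
    Monotone fun z => ∫ w in x..z, γ w := by
  intro a b hab
  have h := intervalIntegral.integral_add_adjacent_intervals (hint x a) (hint a b)
  have h0 : 0 ≤ ∫ w in a..b, γ w :=
    intervalIntegral.integral_nonneg hab fun w _ => (hγ w).1
  dsimp only
  linarith

/-- The primitive of a function with values in `[0, 1)` grows at most at unit speed. -/
theorem monotone_sub_primitive_of_mem_Ico {γ : ℝ → ℝ} (hγ : ∀ w, γ w ∈ Ico (0 : ℝ) 1)
    (hint : ∀ a b, IntervalIntegrable γ volume a b) (x : ℝ) :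
    Monotone fun z => z - ∫ w in x..z, γ w := by
  intro a b hab
  have h := intervalIntegral.integral_add_adjacent_intervals (hint x a) (hint a b)
  have h1 : ∫ w in a..b, γ w ≤ ∫ _ in a..b, (1 : ℝ) :=
    intervalIntegral.integral_mono_on hab (hint a b) intervalIntegrable_const
      fun w _ => (hγ w).2.le
  rw [intervalIntegral.integral_const, smul_eq_mul, mul_one] at h1
  dsimp only
  linarith

theorem intervalIntegrable_of_mem_Ico {γ : ℝ → ℝ} (hγmeas : Measurable γ)
    (hγ : ∀ w, γ w ∈ Ico (0 : ℝ) 1) (a b : ℝ) : IntervalIntegrable γ volume a b := by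
  refine (intervalIntegrable_const (c := (1 : ℝ))).mono_fun
    hγmeas.aestronglyMeasurable (Filter.Eventually.of_forall fun w => ?_)
  dsimp only
  rw [Real.norm_of_nonneg (hγ w).1, norm_one]
  exact (hγ w).2.le

/-- If both `ξ` and `z ↦ z - ξ z` are monotone, then subtracting `ξ` of the running supremum
from a path subtracts the same quantity from its running supremum. -/
theorem isLUB_image_sub_runningSup {X ξ : ℝ → ℝ} (hbdd : ∀ t, BddAbove (X '' Icc 0 t))
    (hξ : Monotone ξ) (hsub : Monotone fun z => z - ξ z) {t : ℝ} (ht : 0 ≤ t) :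
    IsLUB ((fun s => X s - ξ (sSup (X '' Icc 0 s))) '' Icc 0 t)
      (sSup (X '' Icc 0 t) - ξ (sSup (X '' Icc 0 t))) := by
  have hne : ∀ s, 0 ≤ s → (X '' Icc 0 s).Nonempty := fun s hs => (nonempty_Icc.2 hs).image X
  have hmono : ∀ s ∈ Icc 0 t, sSup (X '' Icc 0 s) ≤ sSup (X '' Icc 0 t) := fun s hs =>
    csSup_le_csSup (hbdd t) (hne s hs.1) (image_mono (Icc_subset_Icc_right hs.2))
  refine ⟨?_, fun b hb => ?_⟩
  · rintro _ ⟨s, hs, rfl⟩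
    have h1 : X s ≤ sSup (X '' Icc 0 s) :=
      le_csSup (hbdd s) (mem_image_of_mem X (right_mem_Icc.2 hs.1))
    have h2 := hsub (hmono s hs)
    dsimp only at h2 ⊢
    linarith
  · rw [sub_le_iff_le_add]
    refine csSup_le (hne t ht) ?_
    rintro _ ⟨s, hs, rfl⟩
    have h1 := hb (mem_image_of_mem _ hs)
    have h2 := hξ (hmono s hs)
    linarith

/-- **Observation (ii) of Section 4.1** (pathwise running supremum of the taxed process):
if `X : [0,∞) → ℝ` starts at `x` and has finite running supremum
`X̄(t) = sup_{0 ≤ s ≤ t} X(s)`, and `γ` is measurable with values in `[0,1)`, then the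
taxed path `U_γ(s) = X(s) − ξ_γ(X̄(s))`, with `ξ_γ(z) = ∫_x^z γ(w) dw`, satisfies
`sup_{0 ≤ s ≤ t} U_γ(s) = X̄(t) − ξ_γ(X̄(t))` for every `t ≥ 0`. -/
theorem taxed_running_supremum (x : ℝ) (X : ℝ → ℝ) (hX0 : X 0 = x)
    (hbdd : ∀ t, BddAbove (X '' Icc 0 t))
    (γ : ℝ → ℝ) (hγmeas : Measurable γ) (hγ : ∀ w, γ w ∈ Ico (0 : ℝ) 1) :
    ∀ t ≥ (0 : ℝ),
      sSup ((fun s => X s - ∫ w in x..(sSup (X '' Icc 0 s)), γ w) '' Icc 0 t)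
        = sSup (X '' Icc 0 t) - ∫ w in x..(sSup (X '' Icc 0 t)), γ w := by
  intro t ht
  have hint := intervalIntegrable_of_mem_Ico hγmeas hγ
  exact (isLUB_image_sub_runningSup hbdd (monotone_primitive_of_mem_Ico hγ hint x)
    (monotone_sub_primitive_of_mem_Ico hγ hint x) ht).csSup_eq ((nonempty_Icc.2 ht).image _)
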